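/- Let R = 400000 and let j ≥ 1. There exists L* such that for all integers L₀ ≥ L*, setting L = L₀^{10^{j−1}}, the following holds. Let t, t′ ≥ 1 be integers with (1−2^{−(j+7/2)})/R ≤ t′/t ≤ R·(1+2^{−(j+7/2)}), and let n₁,…,n_t and n′₁,…,n′_{t′} be integers with L⁵ ≤ n_i ≤ L⁵ + L and L⁵ ≤ n′_{i′} ≤ L⁵ + L for all i, i′. Then there exist ℓ ≥ 1, an oriented path v₁,…,v_ℓ in {1,…,t}×{1,…,t′} with v₁ = (1,1), v_ℓ = (t,t′) and v_{i+1} − v_i ∈ {(1,0),(0,1)}, and for each i a pair of points b¹(i), b²(i) ∈ {1,…,n_{v_i¹}}×{1,…,n′_{v_i²}} such that: (1) b¹(1) = (1,1) and b²(ℓ) = (n_{v_ℓ¹}, n′_{v_ℓ²}); (2) for 1 < i ≤ ℓ, either b¹(i) = (x,1) with L ≤ x ≤ n_{v_i¹} − L, or b¹(i) = (1,y) with L ≤ y ≤ n′_{v_i²} − L; (3) for 1 ≤ i < ℓ, either b²(i) = (x, n′_{v_i²}) with L ≤ x ≤ n_{v_i¹} − L, or b²(i) = (n_{v_i¹}, y)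 with L ≤ y ≤ n′_{v_i²} − L; (4) for each i, (1−2^{−(j+3)})·(b²(i)₁ − b¹(i)₁) ≤ R·(b²(i)₂ − b¹(i)₂) and (b²(i)₂ − b¹(i)₂) ≤ R·(1+2^{−(j+3)})·(b²(i)₁ − b¹(i)₁); (5) for 1 ≤ i < ℓ, if v_{i+1} = v_i + (1,0) then b²(i) = (n_{v_i¹}, y) and b¹(i+1) = (1, y) for some y, and if v_{i+1} = v_i + (0,1) then b²(i) = (x, n′_{v_i²}) and b¹(i+1) = (x, 1) for some x; and (6) every v_i satisfies |v_i¹ − x·t| + |v_i² − x·t′| ≤ 50 for some real x ∈ [0,1]. -/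

import Mathlib

open Filter

/-- The chunk, in a side made of `n` chunks, that contains the point at fraction `a` of the side:
fraction `0` gives the first chunk and fraction `1` the last one. -/
noncomputable def chunkIndex (n : ℕ) (a : ℝ) : ℕ := ⌊a * ((n : ℝ) - 1)⌋₊ + 1

lemma one_le_chunkIndex (n : ℕ) (a : ℝ) : 1 ≤ chunkIndex n a := by simp [chunkIndex]

@[simp] lemma chunkIndex_zero (n : ℕ) : chunkIndex n 0 = 1 := by simp [chunkIndex]

lemma chunkIndex_one {n : ℕ} (hn : 1 ≤ n) : chunkIndex n 1 = n := by
  obtain ⟨m, rfl⟩ := Nat.exists_eq_add_of_le' hn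
  simp [chunkIndex]

lemma chunkIndex_le_add_one {n : ℕ} (hn : 1 ≤ n) {a : ℝ} (ha : 0 ≤ a) :
    (chunkIndex n a : ℝ) ≤ a * (n - 1) + 1 := by
  have hn' : (1 : ℝ) ≤ n := by exact_mod_cast hn
  have := Nat.floor_le (mul_nonneg ha (sub_nonneg.2 hn'))
  rw [chunkIndex]
  push_cast
  linarith

lemma lt_chunkIndex (n : ℕ) (a : ℝ) : a * (n - 1) < chunkIndex n a := by
  have := Nat.lt_floor_add_one (a * ((n : ℝ) - 1))
  rw [chunkIndex]
  exact_mod_cast this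

lemma chunkIndex_le {n : ℕ} (hn : 1 ≤ n) {a : ℝ} (ha : 0 ≤ a) (ha' : a ≤ 1) :
    chunkIndex n a ≤ n := by
  have hn' : (1 : ℝ) ≤ n := by exact_mod_cast hn
  have := chunkIndex_le_add_one hn ha
  have : (chunkIndex n a : ℝ) ≤ n := by nlinarith
  exact_mod_cast this

lemma eventually_chunkIndex_away {δ : ℝ} (hδ : 0 < δ) :
    ∀ᶠ L : ℕ in atTop, ∀ n : ℕ, L ^ 5 ≤ n → ∀ a : ℝ, δ ≤ a → a ≤ 1 - δ →
      L ≤ chunkIndex n a ∧ chunkIndex n a + L ≤ n := by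
  filter_upwards [eventually_ge_atTop 1,
    tendsto_natCast_atTop_atTop.eventually_ge_atTop (2 / δ)] with L h1 hL n hn a ha ha'
  have hn1 : 1 ≤ n := (Nat.one_le_pow _ _ h1).trans hn
  have h1' : (1 : ℝ) ≤ L := by exact_mod_cast h1
  have hn' : (L : ℝ) ^ 5 ≤ n := by exact_mod_cast hn
  have h2 : (L : ℝ) ^ 2 ≤ L ^ 5 := pow_le_pow_right₀ h1' (by norm_num)
  rw [div_le_iff₀ hδ] at hL
  have key : (L : ℝ) ≤ δ * (n - 1) := by nlinarith
  have hn1' : (1 : ℝ) ≤ n := by exact_mod_cast hn1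
  have hlow := lt_chunkIndex n a
  have hup := chunkIndex_le_add_one hn1 (hδ.le.trans ha)
  constructor
  · have : (L : ℝ) ≤ chunkIndex n a := by nlinarith
    exact_mod_cast this
  · have : (chunkIndex n a : ℝ) + L ≤ n := by nlinarith
    exact_mod_cast this

lemma eventually_chunkIndex_sub_le {κ κ' δ : ℝ} (hκ : 0 ≤ κ) (hκ' : κ < κ') (hδ : 0 < δ) :
    ∀ᶠ L : ℕ in atTop, ∀ m n : ℕ, L ^ 5 ≤ m → m ≤ L ^ 5 + L → L ^ 5 ≤ n →
      ∀ a₁ a₂ b₁ b₂ : ℝ, 0 ≤ a₁ → a₁ ≤ a₂ → 0 ≤ b₁ → b₁ + δ ≤ b₂ →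
      a₂ - a₁ ≤ κ * (b₂ - b₁) →
      (chunkIndex m a₂ : ℝ) - chunkIndex m a₁ ≤
        κ' * ((chunkIndex n b₂ : ℝ) - chunkIndex n b₁) := by
  filter_upwards [eventually_ge_atTop 1, tendsto_natCast_atTop_atTop.eventually_ge_atTop
    ((κ + κ' + (1 + κ') / δ) / (κ' - κ))] with L h1 hL m n hm hm' hn a₁ a₂ b₁ b₂ ha ha' hb hb' hab
  have hm1 : 1 ≤ m := (Nat.one_le_pow _ _ h1).trans hm
  have hn1 : 1 ≤ n := (Nat.one_le_pow _ _ h1).trans hn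
  have h1' : (1 : ℝ) ≤ L := by exact_mod_cast h1
  have hn' : (L : ℝ) ^ 5 ≤ n := by exact_mod_cast hn
  have hmr : (m : ℝ) ≤ L ^ 5 + L := by exact_mod_cast hm'
  have hm1' : (1 : ℝ) ≤ m := by exact_mod_cast hm1
  have h2 : (L : ℝ) ^ 2 ≤ L ^ 5 := pow_le_pow_right₀ h1' (by norm_num)
  have hpos : 0 < κ' := hκ.trans_lt hκ'
  rw [div_le_iff₀ (sub_pos.2 hκ')] at hL
  have hQ : (1 + κ') ≤ (b₂ - b₁) * ((1 + κ') / δ) := by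
    calc 1 + κ' = δ * ((1 + κ') / δ) := by field_simp
      _ ≤ _ := by gcongr; linarith
  have hE : 0 ≤ (1 + κ') / δ := by positivity
  set E := (1 + κ') / δ
  set Q := b₂ - b₁
  have hQ0 : 0 < Q := by simp only [Q]; linarith
  have hbig : κ * L + κ' + E ≤ (κ' - κ) * (L : ℝ) ^ 5 := by
    calc κ * L + κ' + E ≤ (κ + κ' + E) * L := by nlinarith
      _ ≤ (L * (κ' - κ)) * L := by gcongr
      _ = (κ' - κ) * (L : ℝ) ^ 2 := by ring
      _ ≤ _ := by gcongr
  have e1 := chunkIndex_le_add_one hm1 (ha.trans ha')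
  have e2 := lt_chunkIndex m a₁
  have e3 := lt_chunkIndex n b₂
  have e4 := chunkIndex_le_add_one hn1 hb
  calc (chunkIndex m a₂ : ℝ) - chunkIndex m a₁ ≤ (a₂ - a₁) * (m - 1) + 1 := by linarith
    _ ≤ κ * Q * (L ^ 5 + L) + 1 := by
      gcongr
      linarith
    _ ≤ κ' * (Q * (L ^ 5 - 1) - 1) := by nlinarith
    _ ≤ κ' * (Q * (n - 1) - 1) := by gcongr
    _ ≤ _ := by
      refine mul_le_mul_of_nonneg_left ?_ hpos.le
      simp only [Q]
      linarith

lemma crossing_fraction_bounds {a b r β c : ℝ} (hβ : 0 < β) (hc : b - a ≤ c) (ha : a + β ≤ r)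
    (hb : r + β ≤ b) : β / c ≤ (r - a) / (b - a) ∧ (r - a) / (b - a) ≤ 1 - β / c := by
  have hpos : 0 < b - a := by linarith
  have hd : β / c ≤ β / (b - a) := by gcongr
  refine ⟨hd.trans (by gcongr; linarith), ?_⟩
  rw [le_sub_iff_add_le, ← le_sub_iff_add_le', one_sub_div hpos.ne']
  exact hd.trans (by gcongr; linarith)

lemma segment_fraction_bounds {a σ h₁ h₂ β c κ κ' : ℝ} (hβ : 0 < β) (hσ : 0 < σ) (hc : σ ≤ c)
    (hκ : 1 ≤ κ * σ) (hκ' : σ ≤ κ') (ha : a ≤ h₁) (hh : h₁ + β ≤ h₂) :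
    0 ≤ (h₁ - a) / σ ∧ (h₁ - a) / σ + β / c ≤ (h₂ - a) / σ ∧
      (h₂ - a) / σ - (h₁ - a) / σ ≤ κ * (h₂ - h₁) ∧
      h₂ - h₁ ≤ κ' * ((h₂ - a) / σ - (h₁ - a) / σ) := by
  have hdiff : (h₂ - a) / σ - (h₁ - a) / σ = (h₂ - h₁) / σ := by
    rw [← sub_div, sub_sub_sub_cancel_right]
  have hh' : 0 ≤ h₂ - h₁ := by linarith
  refine ⟨div_nonneg (by linarith) hσ.le, ?_, ?_, ?_⟩
  · rw [← le_sub_iff_add_le', hdiff]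
    gcongr
    linarith
  · rw [hdiff, div_le_iff₀ hσ]
    nlinarith
  · rw [hdiff, mul_div_assoc', le_div_iff₀ hσ]
    nlinarith

lemma rpow_neg_add_lt (j : ℕ) {c : ℝ} (hc : 3 < c) :
    (2 : ℝ) ^ (-((j : ℝ) + c)) < ((2 : ℝ) ^ (j + 3))⁻¹ := by
  rw [← Real.rpow_natCast, ← Real.rpow_neg (by norm_num)]
  refine Real.rpow_lt_rpow_of_exponent_lt (by norm_num) ?_
  push_cast
  linarith

lemma exists_mesh_le (ρ : ℝ) {ε : ℝ} (hε : 0 < ε) :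
    ∃ K : ℕ, 1 ≤ K ∧ 4 * (1 / (2 * (K : ℝ)) * ρ) ≤ ε := by
  obtain ⟨K, hK⟩ := exists_nat_ge (2 * ρ / ε)
  refine ⟨K + 1, by omega, ?_⟩
  have hK0 : (0 : ℝ) < (K + 1 : ℕ) := by positivity
  have : 4 * (1 / (2 * ((K + 1 : ℕ) : ℝ)) * ρ) = 2 * ρ / (K + 1 : ℕ) := by field_simp; norm_num
  rw [this, div_le_iff₀ hK0]
  rw [div_le_iff₀ hε] at hK
  push_cast
  linarith

/-- A height profile following the line of slope `t' / t` that, strictly between its ends, stays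
away from the integers. -/
lemma exists_profile {K t : ℕ} (hK : 1 ≤ K) (ht : 1 ≤ t) (t' : ℕ) :
    ∃ y : ℕ → ℝ, y 0 = 0 ∧ y t = t' ∧
      (∀ i, |y i - i * ((t' : ℝ) / t)| ≤ 1 / (2 * K)) ∧
      ∀ i, 0 < i → i < t → ∀ r : ℕ, (r : ℝ) + 1 / (2 * K) ≤ y i ∨ y i + 1 / (2 * K) ≤ r := by
  have hK0 : (0 : ℝ) < K := by exact_mod_cast hK
  have ht0 : (t : ℝ) ≠ 0 := by positivity
  set s : ℝ := (t' : ℝ) / t with hs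
  have hst : t * s = t' := by rw [hs]; field_simp
  refine ⟨fun i => if i = 0 then 0 else if i = t then t' else ((⌊K * (i * s)⌋ : ℝ) + 1 / 2) / K,
    by simp, by simp; omega, fun i => ?_, fun i hi hi' r => ?_⟩
  · dsimp only
    split_ifs with h h'
    · simp [h]
    · simp [h', hst]
    · have e1 := Int.floor_le (K * (i * s))
      have e2 := Int.lt_floor_add_one (K * (i * s))
      rw [abs_le]
      constructor
      · rw [← sub_nonneg]
        have : ((⌊K * (i * s)⌋ : ℝ) + 1 / 2) / K - i * s - -(1 / (2 * K)) =
          ((⌊K * (i * s)⌋ : ℝ) + 1 - K * (i * s)) / K := by field_simp; ring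
        rw [this]
        exact div_nonneg (by linarith) hK0.le
      · rw [← sub_nonneg]
        have : 1 / (2 * K) - (((⌊K * (i * s)⌋ : ℝ) + 1 / 2) / K - i * s) =
          (K * (i * s) - (⌊K * (i * s)⌋ : ℝ)) / K := by field_simp; ring
        rw [this]
        exact div_nonneg (by linarith) hK0.le
  · simp only [hi.ne', hi'.ne, if_false]
    rcases le_or_gt ((K * r : ℕ) : ℤ) ⌊K * (i * s)⌋ with h | h
    · left
      have h' : ((K * r : ℕ) : ℝ) ≤ ⌊K * (i * s)⌋ := by exact_mod_cast h
      push_cast at h'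
      rw [le_div_iff₀ hK0]
      have : ((r : ℝ) + 1 / (2 * K)) * K = K * r + 1 / 2 := by field_simp
      linarith
    · right
      have h' : (⌊K * (i * s)⌋ : ℝ) + 1 ≤ ((K * r : ℕ) : ℝ) := by exact_mod_cast h
      push_cast at h'
      rw [← le_sub_iff_add_le, div_le_iff₀ hK0]
      have : ((r : ℝ) - 1 / (2 * K)) * K = K * r - 1 / 2 := by field_simp
      linarith

/-- The graph of `y` meets the cell `v` along a piece of height at least `β`. -/
structure MeetsCell (t t' : ℕ) (y : ℕ → ℝ) (β : ℝ) (v : ℕ × ℕ) : Prop where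
  one_le_fst : 1 ≤ v.1
  fst_le : v.1 ≤ t
  one_le_snd : 1 ≤ v.2
  snd_le : v.2 ≤ t'
  left_le : y (v.1 - 1) + β ≤ v.2
  le_right : (v.2 : ℝ) - 1 + β ≤ y v.1

/-- The cells met by the graph of an increasing profile form an oriented path. -/
lemma exists_path_of_profile {t t' : ℕ} {y : ℕ → ℝ} {β : ℝ} (ht : 1 ≤ t) (ht' : 1 ≤ t')
    (hβ : 0 < β) (hβ1 : β ≤ 1) (hy0 : y 0 = 0) (hyt : y t = t')
    (hmono : ∀ i < t, y i + β ≤ y (i + 1)) (hle : ∀ i ≤ t, y i ≤ t')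
    (havoid : ∀ i, 0 < i → i < t → ∀ r : ℕ, (r : ℝ) + β ≤ y i ∨ y i + β ≤ r) :
    ∃ v : ℕ → ℕ × ℕ, v 1 = (1, 1) ∧ v (t + t' - 1) = (t, t') ∧
      (∀ k, 1 ≤ k → k ≤ t + t' - 1 → MeetsCell t t' y β (v k)) ∧
      ∀ k, 1 ≤ k → k < t + t' - 1 →
        (v (k + 1) = v k + (1, 0) ∧ y (v k).1 + β ≤ (v k).2) ∨
        (v (k + 1) = v k + (0, 1) ∧ ((v k).2 : ℝ) + β ≤ y (v k).1) := by
  classical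
  let step : ℕ × ℕ → ℕ × ℕ := fun p => if (p.2 : ℝ) + β ≤ y p.1 then p + (0, 1) else p + (1, 0)
  let v : ℕ → ℕ × ℕ := fun k => step^[k - 1] (1, 1)
  have hv : ∀ k, 1 ≤ k → v (k + 1) = step (v k) := by
    intro k hk
    obtain ⟨m, rfl⟩ := Nat.exists_eq_add_of_le' hk
    simp only [v, Nat.add_sub_cancel, Function.iterate_succ_apply']
  have hstep : ∀ p, MeetsCell t t' y β p → p.1 + p.2 < t + t' →
      MeetsCell t t' y β (step p) ∧ (step p).1 + (step p).2 = p.1 + p.2 + 1 ∧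
        ((step p = p + (1, 0) ∧ y p.1 + β ≤ p.2) ∨
          (step p = p + (0, 1) ∧ (p.2 : ℝ) + β ≤ y p.1)) := by
    rintro ⟨i, r⟩ ⟨h1, h2, h3, h4, h5, h6⟩ hlt
    simp only at h1 h2 h3 h4 h5 h6 hlt
    by_cases h : (r : ℝ) + β ≤ y i
    · have e : step (i, r) = (i, r + 1) := by simp [step, h]
      have hr : r < t' := by
        have : (r : ℝ) < t' := by linarith [hle i h2]
        exact_mod_cast this
      refine ⟨e ▸ ⟨h1, h2, by simp, hr, ?_, ?_⟩, by simp only [e]; omega, Or.inr ⟨by simp [e], h⟩⟩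
      · push_cast; linarith
      · push_cast; linarith
    · have e : step (i, r) = (i + 1, r) := by simp [step, h]
      have hi : i < t := by
        refine lt_of_le_of_ne h2 fun hit => h ?_
        have : r + 1 ≤ t' := by omega
        have : (r : ℝ) + 1 ≤ t' := by exact_mod_cast this
        rw [hit, hyt]
        linarith
      have h' := (havoid i h1 hi r).resolve_left h
      refine ⟨e ▸ ⟨by simp, hi, h3, h4, by simpa using h', ?_⟩, by simp only [e]; omega,
        Or.inl ⟨by simp [e], h'⟩⟩
      have := hmono i hi
      simp only
      linarith
  have hinv : ∀ k, 1 ≤ k → k ≤ t + t' - 1 →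
      MeetsCell t t' y β (v k) ∧ (v k).1 + (v k).2 = k + 1 := by
    intro k hk
    induction k, hk using Nat.le_induction with
    | base =>
      intro _
      have := hmono 0 (by omega)
      refine ⟨⟨le_rfl, ht, le_rfl, ht', ?_, ?_⟩, rfl⟩
      · simpa [v, hy0] using hβ1
      · simpa [v, hy0] using this
    | succ k hk ih =>
      intro hk'
      obtain ⟨hm, hs⟩ := ih (by omega)
      obtain ⟨a, b, -⟩ := hstep (v k) hm (by omega)
      rw [hv k hk]
      exact ⟨a, by omega⟩
  refine ⟨v, rfl, ?_, fun k hk hk' => (hinv k hk hk').1, fun k hk hk' => ?_⟩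
  · obtain ⟨hm, hs⟩ := hinv (t + t' - 1) (by omega) le_rfl
    have := hm.fst_le
    have := hm.snd_le
    ext
    · show (v _).1 = t
      omega
    · show (v _).2 = t'
      omega
  · obtain ⟨hm, hs⟩ := hinv k hk hk'.le
    rw [hv k hk]
    exact (hstep (v k) hm (by omega)).2.2

/-- The chunk of the cell `v` containing the point at height `h` on the graph of the piecewise
linear function interpolating `y`. -/
noncomputable def graphChunk (y : ℕ → ℝ) (n n' : ℕ → ℕ) (v : ℕ × ℕ) (h : ℝ) : ℕ × ℕ :=
  (chunkIndex (n v.1) ((h - y (v.1 - 1)) / (y v.1 - y (v.1 - 1))),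
    chunkIndex (n' v.2) (h - (v.2 - 1)))

/-- The height at which the graph of `y` enters the cell `v`. -/
noncomputable def entryHeight (y : ℕ → ℝ) (v : ℕ × ℕ) : ℝ := max (y (v.1 - 1)) (v.2 - 1)

/-- The height at which the graph of `y` leaves the cell `v`. -/
noncomputable def exitHeight (y : ℕ → ℝ) (v : ℕ × ℕ) : ℝ := min (y v.1) v.2

section Cell

variable {t t' : ℕ} {y : ℕ → ℝ} {β : ℝ} {v : ℕ × ℕ} {n n' : ℕ → ℕ}

lemma MeetsCell.entryHeight_add_le_exitHeight (hv : MeetsCell t t' y β v) (hβ1 : β ≤ 1)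
    (hinc : y (v.1 - 1) + β ≤ y v.1) : entryHeight y v + β ≤ exitHeight y v := by
  have := hv.left_le
  have := hv.le_right
  rw [entryHeight, exitHeight, max_add, le_min_iff, max_le_iff, max_le_iff]
  refine ⟨⟨hinc, by linarith⟩, by linarith, by linarith⟩

lemma graphChunk_exitHeight_of_right (hβ : 0 < β) (h : y v.1 + β ≤ v.2)
    (hinc : y (v.1 - 1) < y v.1) (hn : 1 ≤ n v.1) :
    graphChunk y n n' v (exitHeight y v) =
      (n v.1, chunkIndex (n' v.2) (y v.1 - (v.2 - 1))) := by
  rw [graphChunk, exitHeight, min_eq_left (by linarith), div_self (sub_pos.2 hinc).ne',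
    chunkIndex_one hn]

lemma graphChunk_exitHeight_of_up (hβ : 0 < β) (h : (v.2 : ℝ) + β ≤ y v.1)
    (hn : 1 ≤ n' v.2) :
    graphChunk y n n' v (exitHeight y v) =
      (chunkIndex (n v.1) ((v.2 - y (v.1 - 1)) / (y v.1 - y (v.1 - 1))), n' v.2) := by
  rw [graphChunk, exitHeight, min_eq_right (by linarith), sub_sub_cancel, chunkIndex_one hn]

lemma MeetsCell.graphChunk_entryHeight_of_right (hv : MeetsCell t t' y β v) (hβ : 0 < β) :
    graphChunk y n n' (v + (1, 0)) (entryHeight y (v + (1, 0))) =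
      (1, chunkIndex (n' v.2) (y v.1 - (v.2 - 1))) := by
  have := hv.le_right
  simp only [graphChunk, entryHeight, Prod.fst_add, Prod.snd_add, add_zero, Nat.add_sub_cancel]
  rw [max_eq_left (by linarith), sub_self, zero_div, chunkIndex_zero]

lemma MeetsCell.graphChunk_entryHeight_of_up (hv : MeetsCell t t' y β v) (hβ : 0 < β) :
    graphChunk y n n' (v + (0, 1)) (entryHeight y (v + (0, 1))) =
      (chunkIndex (n v.1) ((v.2 - y (v.1 - 1)) / (y v.1 - y (v.1 - 1))), 1) := by
  have := hv.left_le
  simp only [graphChunk, entryHeight, Prod.fst_add, Prod.snd_add, add_zero, Nat.cast_add,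
    Nat.cast_one, add_sub_cancel_right]
  rw [max_eq_right (by linarith), sub_self, chunkIndex_zero]

lemma graphChunk_mem (hinc : y (v.1 - 1) < y v.1) (hn : 1 ≤ n v.1) (hn' : 1 ≤ n' v.2)
    {h : ℝ} (h1 : entryHeight y v ≤ h) (h2 : h ≤ exitHeight y v) :
    1 ≤ (graphChunk y n n' v h).1 ∧ (graphChunk y n n' v h).1 ≤ n v.1 ∧
      1 ≤ (graphChunk y n n' v h).2 ∧ (graphChunk y n n' v h).2 ≤ n' v.2 := by
  obtain ⟨h3, h4⟩ := max_le_iff.1 h1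
  obtain ⟨h5, h6⟩ := le_min_iff.1 h2
  have hpos := sub_pos.2 hinc
  exact ⟨one_le_chunkIndex _ _,
    chunkIndex_le hn (div_nonneg (by linarith) hpos.le) ((div_le_one hpos).2 (by linarith)),
    one_le_chunkIndex _ _, chunkIndex_le hn' (by linarith) (by linarith)⟩

lemma MeetsCell.exists_near_diagonal (hv : MeetsCell t t' y β v) (hβ : 0 < β)
    (hβs : β ≤ (t' : ℝ) / t) (ht : 1 ≤ t) (ht' : 1 ≤ t')
    (hyline : ∀ i, |y i - i * ((t' : ℝ) / t)| ≤ β)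
    (hh : entryHeight y v + β ≤ exitHeight y v) :
    ∃ x : ℝ, 0 ≤ x ∧ x ≤ 1 ∧ |(v.1 : ℝ) - x * t| + |(v.2 : ℝ) - x * t'| ≤ 50 := by
  have htpos : (0 : ℝ) < t := by exact_mod_cast ht
  have htpos' : (0 : ℝ) < t' := by exact_mod_cast ht'
  set s : ℝ := (t' : ℝ) / t with hs_def
  have hs0 : 0 < s := by positivity
  have e1 := abs_le.1 (hyline v.1)
  have e2 := abs_le.1 (hyline (v.1 - 1))
  rw [Nat.cast_sub hv.one_le_fst, Nat.cast_one] at e2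
  have hen1 : y (v.1 - 1) ≤ entryHeight y v := le_max_left _ _
  have hen2 : (v.2 : ℝ) - 1 ≤ entryHeight y v := le_max_right _ _
  have hex1 : exitHeight y v ≤ y v.1 := min_le_left _ _
  have hex2 : exitHeight y v ≤ v.2 := min_le_right _ _
  have hr1 : (1 : ℝ) ≤ v.2 := by exact_mod_cast hv.one_le_snd
  have hr2 : (v.2 : ℝ) ≤ t' := by exact_mod_cast hv.snd_le
  set h := entryHeight y v
  refine ⟨h / t', div_nonneg (by linarith) htpos'.le,
    (div_le_one htpos').2 (by linarith), ?_⟩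
  have hx : h / t' * t = h / s := by
    rw [hs_def]
    field_simp
  rw [hx, div_mul_cancel₀ _ htpos'.ne']
  have b1 : |(v.1 : ℝ) - h / s| ≤ 2 := by
    have c1 : h / s ≤ v.1 + 1 := by rw [div_le_iff₀ hs0]; linarith
    have c2 : (v.1 : ℝ) - 2 ≤ h / s := by rw [le_div_iff₀ hs0]; linarith
    rw [abs_le]
    constructor <;> linarith
  have b2 : |(v.2 : ℝ) - h| ≤ 1 := by
    rw [abs_le]
    constructor <;> linarith
  linarith

end Cell


/-- **Existence of a corner-to-corner route** (Lemma on routes in `A ⊗ B`).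
With `R = 400000`, `j ≥ 1` and `L = L₀^(10^(j-1))` for `L₀` large enough: given a
`t × t'` grid of rectangles of sizes `n_i × n'_{i'}` with `L⁵ ≤ n_i, n'_{i'} ≤ L⁵ + L`
and `(1-2^{-(j+7/2)})/R ≤ t'/t ≤ R(1+2^{-(j+7/2)})`, there is an oriented path
`v₁ = (1,1), …, v_ℓ = (t,t')` through the grid along with entry points `b¹(i)` and
exit points `b²(i)` in each traversed rectangle satisfying the boundary, slope,
matching and diagonal-proximity conditions. -/
theorem corner_to_corner_route_exists (R j : ℕ) (hR : R = 400000) (hj : 1 ≤ j) :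
    ∃ Lstar : ℕ, ∀ L₀ : ℕ, Lstar ≤ L₀ →
    ∀ L : ℕ, L = L₀ ^ 10 ^ (j - 1) →
    ∀ t t' : ℕ, 1 ≤ t → 1 ≤ t' →
    (1 - (2 : ℝ) ^ (-((j : ℝ) + 7 / 2))) / R ≤ (t' : ℝ) / t →
    (t' : ℝ) / t ≤ R * (1 + (2 : ℝ) ^ (-((j : ℝ) + 7 / 2))) →
    ∀ n n' : ℕ → ℕ,
    (∀ i, 1 ≤ i → i ≤ t → L ^ 5 ≤ n i ∧ n i ≤ L ^ 5 + L) →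
    (∀ i, 1 ≤ i → i ≤ t' → L ^ 5 ≤ n' i ∧ n' i ≤ L ^ 5 + L) →
    ∃ (ℓ : ℕ) (v b₁ b₂ : ℕ → ℕ × ℕ), 1 ≤ ℓ ∧
      -- `v` is an oriented path through the grid from `(1,1)` to `(t,t')`
      v 1 = (1, 1) ∧ v ℓ = (t, t') ∧
      (∀ i, 1 ≤ i → i < ℓ → v (i + 1) = v i + (1, 0) ∨ v (i + 1) = v i + (0, 1)) ∧
      -- the points `b¹(i)`, `b²(i)` lie in the rectangle `{1,…,n_{v_i¹}} × {1,…,n'_{v_i²}}`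
      (∀ i, 1 ≤ i → i ≤ ℓ →
        (1 ≤ (b₁ i).1 ∧ (b₁ i).1 ≤ n (v i).1 ∧ 1 ≤ (b₁ i).2 ∧ (b₁ i).2 ≤ n' (v i).2) ∧
        (1 ≤ (b₂ i).1 ∧ (b₂ i).1 ≤ n (v i).1 ∧ 1 ≤ (b₂ i).2 ∧ (b₂ i).2 ≤ n' (v i).2)) ∧
      -- (1) route from corner to corner
      b₁ 1 = (1, 1) ∧ b₂ ℓ = (n (v ℓ).1, n' (v ℓ).2) ∧
      -- (2) entry points lie on the bottom or left side, away from the corners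
      (∀ i, 1 < i → i ≤ ℓ →
        ((b₁ i).2 = 1 ∧ L ≤ (b₁ i).1 ∧ (b₁ i).1 + L ≤ n (v i).1) ∨
        ((b₁ i).1 = 1 ∧ L ≤ (b₁ i).2 ∧ (b₁ i).2 + L ≤ n' (v i).2)) ∧
      -- (3) exit points lie on the top or right side, away from the corners
      (∀ i, 1 ≤ i → i < ℓ →
        ((b₂ i).2 = n' (v i).2 ∧ L ≤ (b₂ i).1 ∧ (b₂ i).1 + L ≤ n (v i).1) ∨
        ((b₂ i).1 = n (v i).1 ∧ L ≤ (b₂ i).2 ∧ (b₂ i).2 + L ≤ n' (v i).2)) ∧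
      -- (4) slope condition within each rectangle
      (∀ i, 1 ≤ i → i ≤ ℓ →
        (1 - ((2 : ℝ) ^ (j + 3))⁻¹) * (((b₂ i).1 : ℝ) - ((b₁ i).1 : ℝ)) ≤
            R * (((b₂ i).2 : ℝ) - ((b₁ i).2 : ℝ)) ∧
        (((b₂ i).2 : ℝ) - ((b₁ i).2 : ℝ)) ≤
            R * (1 + ((2 : ℝ) ^ (j + 3))⁻¹) * (((b₂ i).1 : ℝ) - ((b₁ i).1 : ℝ))) ∧
      -- (5) consecutive exit and entry points match across the shared side
      (∀ i, 1 ≤ i → i < ℓ →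
        (v (i + 1) = v i + (1, 0) →
          (b₂ i).1 = n (v i).1 ∧ b₁ (i + 1) = (1, (b₂ i).2)) ∧
        (v (i + 1) = v i + (0, 1) →
          (b₂ i).2 = n' (v i).2 ∧ b₁ (i + 1) = ((b₂ i).1, 1))) ∧
      -- (6) the route stays near the diagonal of the grid
      (∀ i, 1 ≤ i → i ≤ ℓ → ∃ x : ℝ, 0 ≤ x ∧ x ≤ 1 ∧
        |((v i).1 : ℝ) - x * t| + |((v i).2 : ℝ) - x * t'| ≤ 50) := by
  set τ₀ : ℝ := ((2 : ℝ) ^ (j + 3))⁻¹ with hτ₀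
  set τ : ℝ := (2 : ℝ) ^ (-((j : ℝ) + 7 / 2)) with hτ
  set ρ : ℝ := (R : ℝ) with hρ
  have hρ1 : 1 ≤ ρ := by rw [hρ, hR]; norm_num
  have hτpos : 0 < τ := by positivity
  have hττ : τ < τ₀ := rpow_neg_add_lt j (by norm_num)
  have hτ₀' : τ₀ ≤ 1 / 16 := by
    rw [hτ₀, one_div]
    apply inv_anti₀ (by norm_num)
    calc (16 : ℝ) = 2 ^ 4 := by norm_num
      _ ≤ _ := pow_le_pow_right₀ (by norm_num) (by omega)
  obtain ⟨K, hK, hβρ⟩ := exists_mesh_le ρ (sub_pos.2 hττ)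
  have hK0 : (0 : ℝ) < K := by exact_mod_cast hK
  obtain ⟨β, hβ⟩ : ∃ β : ℝ, β = 1 / (2 * K) := ⟨_, rfl⟩
  rw [← hβ] at hβρ
  have hβ0 : 0 < β := by rw [hβ]; positivity
  have hββ : β ≤ β * ρ := le_mul_of_one_le_right hβ0.le hρ1
  have hβ1 : β ≤ 1 := by linarith
  obtain ⟨τ₁, hτ₁⟩ : ∃ τ₁ : ℝ, τ₁ = (τ + τ₀) / 2 := ⟨_, rfl⟩
  have hδ : 0 < β / (2 * ρ) := by positivity
  have hκ : ρ / (1 - τ₁) < ρ / (1 - τ₀) :=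
    div_lt_div_of_pos_left (by linarith) (by linarith) (by linarith)
  have hκ' : ρ * (1 + τ₁) < ρ * (1 + τ₀) := by gcongr; linarith
  obtain ⟨Lstar, hLstar⟩ := eventually_atTop.1 ((eventually_chunkIndex_away hδ).and
    ((eventually_chunkIndex_sub_le (div_nonneg (by linarith) (by linarith)) hκ hβ0).and
      ((eventually_chunkIndex_sub_le (mul_nonneg (by linarith) (by linarith)) hκ' hδ).and
        (eventually_ge_atTop 1))))
  refine ⟨Lstar, fun L₀ hL₀ L hL t t' ht ht' hs hs' n n' hn hn' => ?_⟩
  have hLL : Lstar ≤ L := hL₀.trans (hL ▸ Nat.le_self_pow (by positivity) L₀)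
  obtain ⟨haway, hslope, hslope', hL1⟩ := hLstar L hLL
  have hL5 : 1 ≤ L ^ 5 := Nat.one_le_pow _ _ hL1
  have hn1 : ∀ i, 1 ≤ i → i ≤ t → 1 ≤ n i := fun i h h' => hL5.trans (hn i h h').1
  have hn1' : ∀ i, 1 ≤ i → i ≤ t' → 1 ≤ n' i := fun i h h' => hL5.trans (hn' i h h').1
  have htpos : (0 : ℝ) < t := by exact_mod_cast ht
  have htpos' : (0 : ℝ) < t' := by exact_mod_cast ht'
  obtain ⟨y, hy0, hyt, hyline, havoid⟩ := exists_profile hK ht t'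
  rw [← hβ] at hyline havoid
  set s : ℝ := (t' : ℝ) / t with hs_def
  have hs0 : 0 < s := by positivity
  have hts : (t : ℝ) * s = t' := by rw [hs_def]; field_simp
  rw [div_le_iff₀ (by linarith)] at hs
  have hsβ : 3 * β ≤ s := by nlinarith
  have hinc : ∀ i, s - 2 * β ≤ y (i + 1) - y i ∧ y (i + 1) - y i ≤ s + 2 * β := by
    intro i
    have e1 := abs_le.1 (hyline i)
    have e2 := abs_le.1 (hyline (i + 1))
    push_cast at e2
    constructor <;> linarith
  have hmono : Monotone y := monotone_nat_of_le_succ fun i => by linarith [(hinc i).1]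
  obtain ⟨v, hv1, hvℓ, hmeets, hstep⟩ := exists_path_of_profile ht ht' hβ0 hβ1 hy0 hyt
    (fun i _ => by linarith [(hinc i).1]) (fun i hi => hyt ▸ hmono hi) havoid
  have hσ : ∀ k, 1 ≤ k → k ≤ t + t' - 1 →
      s - 2 * β ≤ y (v k).1 - y ((v k).1 - 1) ∧
        y (v k).1 - y ((v k).1 - 1) ≤ s + 2 * β := by
    intro k hk hk'
    have := hinc ((v k).1 - 1)
    rwa [Nat.sub_add_cancel (hmeets k hk hk').one_le_fst] at this
  have hlt : ∀ k, 1 ≤ k → k ≤ t + t' - 1 → y ((v k).1 - 1) + β ≤ y (v k).1 :=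
    fun k hk hk' => by linarith [(hσ k hk hk').1]
  have hheight : ∀ k, 1 ≤ k → k ≤ t + t' - 1 →
      entryHeight y (v k) + β ≤ exitHeight y (v k) := fun k hk hk' =>
    (hmeets k hk hk').entryHeight_add_le_exitHeight hβ1 (hlt k hk hk')
  have hσρ : ∀ k, 1 ≤ k → k ≤ t + t' - 1 → y (v k).1 - y ((v k).1 - 1) ≤ ρ * (1 + τ₁) ∧
      1 - τ₁ ≤ (y (v k).1 - y ((v k).1 - 1)) * ρ := by
    intro k hk hk'
    obtain ⟨e1, e2⟩ := hσ k hk hk'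
    constructor
    · have : τ₀ - τ ≤ ρ * (τ₀ - τ) := le_mul_of_one_le_left (by linarith) hρ1
      rw [hτ₁]
      linarith
    · have : (s - 2 * β) * ρ ≤ (y (v k).1 - y ((v k).1 - 1)) * ρ := by gcongr
      linarith
  have hσ2ρ : ∀ k, 1 ≤ k → k ≤ t + t' - 1 → y (v k).1 - y ((v k).1 - 1) ≤ 2 * ρ :=
    fun k hk hk' => (hσρ k hk hk').1.trans (by nlinarith)
  have hturn : ∀ k, 1 ≤ k → k < t + t' - 1 →
      (v (k + 1) = v k + (1, 0) ∧ ∃ z, L ≤ z ∧ z + L ≤ n' (v k).2 ∧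
        graphChunk y n n' (v k) (exitHeight y (v k)) = (n (v k).1, z) ∧
        graphChunk y n n' (v (k + 1)) (entryHeight y (v (k + 1))) = (1, z)) ∨
      (v (k + 1) = v k + (0, 1) ∧ ∃ z, L ≤ z ∧ z + L ≤ n (v k).1 ∧
        graphChunk y n n' (v k) (exitHeight y (v k)) = (z, n' (v k).2) ∧
        graphChunk y n n' (v (k + 1)) (entryHeight y (v (k + 1))) = (z, 1)) := by
    intro k hk hk'
    have hm := hmeets k hk hk'.le
    have hlt' := hlt k hk hk'.le
    have hl := hm.left_le
    have hr := hm.le_right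
    have hδβ : β / (2 * ρ) ≤ β := div_le_self hβ0.le (by linarith)
    have hnv := hn _ hm.one_le_fst hm.fst_le
    have hnv' := hn' _ hm.one_le_snd hm.snd_le
    rcases hstep k hk hk' with ⟨e, h⟩ | ⟨e, h⟩
    · obtain ⟨z1, z2⟩ := haway _ hnv'.1 (y (v k).1 - ((v k).2 - 1)) (by linarith) (by linarith)
      exact Or.inl ⟨e, _, z1, z2,
        graphChunk_exitHeight_of_right hβ0 h (by linarith) (hL5.trans hnv.1),
        e ▸ hm.graphChunk_entryHeight_of_right hβ0⟩
    · obtain ⟨f1, f2⟩ := crossing_fraction_bounds hβ0 (hσ2ρ k hk hk'.le) hl h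
      obtain ⟨z1, z2⟩ := haway _ hnv.1 _ f1 f2
      exact Or.inr ⟨e, _, z1, z2, graphChunk_exitHeight_of_up hβ0 h (hL5.trans hnv'.1),
        e ▸ hm.graphChunk_entryHeight_of_up hβ0⟩
  refine ⟨t + t' - 1, v, fun k => graphChunk y n n' (v k) (entryHeight y (v k)),
    fun k => graphChunk y n n' (v k) (exitHeight y (v k)), by omega, hv1, hvℓ,
    fun k hk hk' => (hstep k hk hk').imp And.left And.left, ?_, ?_, ?_, ?_, ?_, ?_, ?_, ?_⟩
  · intro k hk hk'
    have hm := hmeets k hk hk'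
    have hlt' : y ((v k).1 - 1) < y (v k).1 := by linarith [hlt k hk hk']
    have hh : entryHeight y (v k) ≤ exitHeight y (v k) := by linarith [hheight k hk hk']
    have hnv := hn1 _ hm.one_le_fst hm.fst_le
    have hnv' := hn1' _ hm.one_le_snd hm.snd_le
    exact ⟨graphChunk_mem hlt' hnv hnv' le_rfl hh, graphChunk_mem hlt' hnv hnv' hh le_rfl⟩
  · simp [hv1, graphChunk, entryHeight, hy0]
  · have : y (t - 1) < y t := by
      have := hlt (t + t' - 1) (by omega) le_rfl
      rw [hvℓ] at this
      simp only at this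
      linarith
    simp only [hvℓ, graphChunk, exitHeight, hyt, min_self, sub_sub_cancel]
    rw [hyt] at this
    rw [div_self (sub_pos.2 this).ne', chunkIndex_one (hn1 t ht le_rfl),
      chunkIndex_one (hn1' t' ht' le_rfl)]
  · intro k hk hk'
    obtain ⟨m, rfl⟩ := Nat.exists_eq_add_of_le' hk.le
    rcases hturn m (by omega) (by omega) with ⟨e, z, h1, h2, -, h4⟩ | ⟨e, z, h1, h2, -, h4⟩
    · right
      simp only [h4]
      exact ⟨trivial, h1, by simpa [e] using h2⟩
    · left
      simp only [h4]
      exact ⟨trivial, h1, by simpa [e] using h2⟩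
  · intro k hk hk'
    rcases hturn k hk hk' with ⟨-, z, h1, h2, h3, -⟩ | ⟨-, z, h1, h2, h3, -⟩
    · exact Or.inr (by simpa only [h3, true_and] using ⟨h1, h2⟩)
    · exact Or.inl (by simpa only [h3, true_and] using ⟨h1, h2⟩)
  · intro k hk hk'
    have hm := hmeets k hk hk'
    have hlt' := hlt k hk hk'
    have hh := hheight k hk hk'
    obtain ⟨hσ1, hσ2⟩ := hσρ k hk hk'
    have hnv := hn _ hm.one_le_fst hm.fst_le
    have hnv' := hn' _ hm.one_le_snd hm.snd_le
    have hen1 : y ((v k).1 - 1) ≤ entryHeight y (v k) := le_max_left _ _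
    have hen2 : ((v k).2 : ℝ) - 1 ≤ entryHeight y (v k) := le_max_right _ _
    simp only [graphChunk]
    obtain ⟨f1, f2, f3, f4⟩ := segment_fraction_bounds (κ := ρ / (1 - τ₁)) hβ0
      (by linarith) (hσ2ρ k hk hk') (by
        rw [div_mul_eq_mul_div, one_le_div (by linarith)]
        linarith) hσ1 hen1 hh
    constructor
    · have := hslope _ _ hnv.1 hnv.2 hnv'.1 _ _ (entryHeight y (v k) - ((v k).2 - 1))
        (exitHeight y (v k) - ((v k).2 - 1)) f1 (le_of_add_le_of_nonneg_left f2 hδ.le)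
        (by linarith) (by linarith) (by rwa [sub_sub_sub_cancel_right])
      rw [div_mul_eq_mul_div, le_div_iff₀ (by linarith)] at this
      linarith
    · exact hslope' _ _ hnv'.1 hnv'.2 hnv.1 (entryHeight y (v k) - ((v k).2 - 1))
        (exitHeight y (v k) - ((v k).2 - 1)) _ _ (by linarith) (by linarith) f1 f2
        (by rwa [sub_sub_sub_cancel_right])
  · intro k hk hk'
    rcases hturn k hk hk' with ⟨e, z, -, -, h3, h4⟩ | ⟨e, z, -, -, h3, h4⟩
    · refine ⟨fun _ => ⟨by simp only [h3], by simp only [h3, h4]⟩, fun h => ?_⟩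
      rw [e, add_right_inj] at h
      simp at h
    · refine ⟨fun h => ?_, fun _ => ⟨by simp only [h3], by simp only [h3, h4]⟩⟩
      rw [e, add_right_inj] at h
      simp at h
  · exact fun k hk hk' =>
      (hmeets k hk hk').exists_near_diagonal hβ0 (by linarith) ht ht' hyline (hheight k hk hk')
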